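/- arXiv:2403.14067 — 4 statements merged into one kernel-verified Lean document; each statement's English description precedes it below -/
import Mathlib

section
/- Let r ∈ (0,1), λ ≥ 0, and θ, z ∈ ℝ^d with the Euclidean norm ‖·‖. Then the infimum over Δ ∈ ℝ^d of ‖θ − z − Δ‖ + λ·‖Δ‖^r is attained and equals min{ ‖θ − z‖, λ·‖θ − z‖^r }. -/
/-- Concavity of `t ↦ a - t + c * t ^ r` on `[0, a]`: it is at least its minimum over the endpoints. -/
lemma min_le_sub_add_mul_rpow {a c r t : ℝ} (hr : r ≤ 1) (hc : 0 ≤ c) (ht : 0 < t) (hta : t ≤ a) :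
    min a (c * a ^ r) ≤ a - t + c * t ^ r := by
  have ha : 0 < a := ht.trans_le hta
  have hs : 0 < t / a := div_pos ht ha
  have hs1 : t / a ≤ 1 := (div_le_one ha).2 hta
  have hta' : t = t / a * a := (div_mul_cancel₀ t ha.ne').symm
  have hpow : t / a * a ^ r ≤ t ^ r := by
    conv_rhs => rw [hta', Real.mul_rpow hs.le ha.le]
    gcongr
    simpa using Real.rpow_le_rpow_of_exponent_ge hs hs1 hr
  calc min a (c * a ^ r)
      = (1 - t / a) * min a (c * a ^ r) + t / a * min a (c * a ^ r) := by ring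
    _ ≤ (1 - t / a) * a + t / a * (c * a ^ r) :=
        add_le_add (mul_le_mul_of_nonneg_left (min_le_left _ _) (sub_nonneg.2 hs1))
          (mul_le_mul_of_nonneg_left (min_le_right _ _) hs.le)
    _ = a - t + c * (t / a * a ^ r) := by
        rw [sub_mul, ← hta']
        ring
    _ ≤ a - t + c * t ^ r := by gcongr

/-- In a seminormed group, the infimal convolution of the norm with `c * ‖·‖ ^ r`, `0 < r ≤ 1`,
is attained at `0` or at the point itself. -/
lemma isLeast_range_norm_sub_add_mul_rpow {E : Type*} [SeminormedAddCommGroup E] {c r : ℝ}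
    (hr₀ : 0 < r) (hr₁ : r ≤ 1) (hc : 0 ≤ c) (v : E) :
    IsLeast (Set.range fun x : E => ‖v - x‖ + c * ‖x‖ ^ r) (min ‖v‖ (c * ‖v‖ ^ r)) := by
  constructor
  · rcases min_choice ‖v‖ (c * ‖v‖ ^ r) with h | h
    · exact ⟨0, by simp [h, Real.zero_rpow hr₀.ne']⟩
    · exact ⟨v, by simp [h]⟩
  · rintro _ ⟨x, rfl⟩
    have hv : ‖v‖ - ‖x‖ ≤ ‖v - x‖ := norm_sub_norm_le v x
    rcases le_total ‖v‖ ‖x‖ with hvx | hvx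
    · calc min ‖v‖ (c * ‖v‖ ^ r) ≤ c * ‖v‖ ^ r := min_le_right _ _
        _ ≤ c * ‖x‖ ^ r := by gcongr
        _ ≤ ‖v - x‖ + c * ‖x‖ ^ r := le_add_of_nonneg_left (norm_nonneg _)
    · rcases (norm_nonneg x).eq_or_lt with hx | hx
      · refine (min_le_left _ _).trans ?_
        have : 0 ≤ c * ‖x‖ ^ r := by positivity
        linarith
      · exact (min_le_sub_add_mul_rpow hr₁ hc hx hvx).trans (by linarith)

/-- For `r ∈ (0,1)`, `λ ≥ 0`, and `θ, z ∈ ℝ^d` with the Euclidean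
norm, the infimum over `Δ ∈ ℝ^d` of `‖θ − z − Δ‖ + λ ‖Δ‖^r` is attained and
equals `min{‖θ − z‖, λ ‖θ − z‖^r}`. -/
theorem stmt_8 (d : ℕ) (r lam : ℝ) (hr : r ∈ Set.Ioo (0 : ℝ) 1) (hlam : 0 ≤ lam)
    (θ z : EuclideanSpace ℝ (Fin d)) :
    IsLeast (Set.range fun Δ : EuclideanSpace ℝ (Fin d) =>
        ‖θ - z - Δ‖ + lam * ‖Δ‖ ^ r)
      (min ‖θ - z‖ (lam * ‖θ - z‖ ^ r)) := by
  exact isLeast_range_norm_sub_add_mul_rpow hr.1 hr.2.le hlam (θ - z)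
end

section
/- Let ‖·‖ be a norm on ℝ^m with dual norm ‖·‖_*, let r ∈ (0,1), λ ≥ 0, let θ̃ ∈ ℝ^m be nonzero, and let z ∈ ℝ^m. Then the infimum over Δ ∈ ℝ^m of |θ̃ᵀ(z + Δ)| + λ·‖Δ‖^r is attained and equals min{ |θ̃ᵀz|, λ·|θ̃ᵀz|^r / ‖θ̃‖_*^r }. -/
/-- A subadditive and absolutely homogeneous function on a real module is nonnegative. -/
theorem nonneg_of_triangle_of_smul {E : Type*} [AddCommGroup E] [Module ℝ E] (N : E → ℝ)
    (hN_triangle : ∀ u v, N (u + v) ≤ N u + N v)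
    (hN_smul : ∀ (a : ℝ) (u), N (a • u) = |a| * N u) (u : E) : 0 ≤ N u := by
  have h0 := hN_smul 0 u
  have h1 := hN_triangle u ((-1 : ℝ) • u)
  rw [zero_smul, abs_zero, zero_mul] at h0
  rw [hN_smul, neg_smul, one_smul, add_neg_cancel, h0, abs_neg, abs_one] at h1
  linarith

/-- On a finite-dimensional real space, a linear functional attains its maximum over the unit ball
of a norm given as a bare function. -/
theorem exists_forall_le_of_norm_le_one {E : Type*} [AddCommGroup E] [Module ℝ E]
    [FiniteDimensional ℝ E] (N : E → ℝ)
    (hN_triangle : ∀ u v, N (u + v) ≤ N u + N v)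
    (hN_smul : ∀ (a : ℝ) (u), N (a • u) = |a| * N u)
    (hN_eq_zero : ∀ u, N u = 0 ↔ u = 0) (f : E →ₗ[ℝ] ℝ) :
    ∃ u, N u ≤ 1 ∧ ∀ v, N v ≤ 1 → f v ≤ f u := by
  have hN_nonneg := nonneg_of_triangle_of_smul N hN_triangle hN_smul
  let _ : Norm E := ⟨N⟩
  have core : NormedSpace.Core ℝ E :=
    { norm_nonneg := hN_nonneg
      norm_smul := fun a u => hN_smul a u
      norm_triangle := hN_triangle
      norm_eq_zero_iff := hN_eq_zero }
  let _ : NormedAddCommGroup E := NormedAddCommGroup.ofCore core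
  let _ : NormedSpace ℝ E := NormedSpace.ofCore core
  have : ProperSpace E := FiniteDimensional.proper ℝ E
  obtain ⟨u, hu, hmax⟩ := (isCompact_closedBall (0 : E) 1).exists_isMaxOn
    ⟨0, Metric.mem_closedBall_self zero_le_one⟩ f.continuous_of_finiteDimensional.continuousOn
  exact ⟨u, mem_closedBall_zero_iff.1 hu, fun v hv => hmax (mem_closedBall_zero_iff.2 hv)⟩

/-- The scalar inequality: moving from `a` by `t` at cost `c * |t| ^ r`, with `r ≤ 1`, is never
cheaper than the better of staying put and moving all the way to `0`. -/
theorem min_abs_le_abs_add_add_mul_rpow {r c a t : ℝ} (hr0 : 0 < r) (hr1 : r ≤ 1) (hc : 0 ≤ c) :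
    min |a| (c * |a| ^ r) ≤ |a + t| + c * |t| ^ r := by
  rcases le_or_gt |a| |t| with h | h
  · calc min |a| (c * |a| ^ r) ≤ c * |a| ^ r := min_le_right _ _
      _ ≤ c * |t| ^ r := by gcongr
      _ ≤ |a + t| + c * |t| ^ r := le_add_of_nonneg_left (abs_nonneg _)
  · have ha : 0 < |a| := (abs_nonneg t).trans_lt h
    have hdiv : |t| / |a| ≤ 1 := (div_le_one ha).2 h.le
    have hdiv0 : 0 ≤ |t| / |a| := by positivity
    have hpow : |t| / |a| * |a| ^ r ≤ |t| ^ r := by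
      calc |t| / |a| * |a| ^ r ≤ (|t| / |a|) ^ r * |a| ^ r := by
            gcongr
            exact Real.self_le_rpow_of_le_one hdiv0 hdiv hr1
        _ = |t| ^ r := by
            rw [← Real.mul_rpow hdiv0 ha.le, div_mul_cancel₀ _ ha.ne']
    have htri : |a| - |t| ≤ |a + t| := by
      simpa using abs_sub_abs_le_abs_sub a (-t)
    have hcancel : |t| / |a| * |a| = |t| := div_mul_cancel₀ _ ha.ne'
    have h1 := mul_le_mul_of_nonneg_left (min_le_left |a| (c * |a| ^ r)) (sub_nonneg.2 hdiv)
    have h2 := mul_le_mul_of_nonneg_left (min_le_right |a| (c * |a| ^ r)) hdiv0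
    have h3 := mul_le_mul_of_nonneg_left hpow hc
    linarith

/-- Let `N` be a norm on `ℝ^m` with dual norm `Nd`, `r ∈ (0,1)`,
`λ ≥ 0`, `θ̃ ≠ 0` and `z ∈ ℝ^m`.  Then the infimum over `Δ ∈ ℝ^m` of
`|θ̃ᵀ(z + Δ)| + λ N(Δ)^r` is attained and equals
`min{ |θ̃ᵀz|, λ |θ̃ᵀz|^r / Nd(θ̃)^r }`. -/
theorem stmt_9 (m : ℕ) (r lam : ℝ) (hr : r ∈ Set.Ioo (0 : ℝ) 1) (hlam : 0 ≤ lam)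
    (N : (Fin m → ℝ) → ℝ)
    (hN_triangle : ∀ u v, N (u + v) ≤ N u + N v)
    (hN_smul : ∀ (a : ℝ) (u), N (a • u) = |a| * N u)
    (hN_eq_zero : ∀ u, N u = 0 ↔ u = 0)
    (θt z : Fin m → ℝ) (hθt : θt ≠ 0)
    (Nd : ℝ)
    (hNd : Nd = sSup {v : ℝ | ∃ u : Fin m → ℝ, N u ≤ 1 ∧ v = ∑ i, θt i * u i}) :
    IsLeast (Set.range fun Δ : Fin m → ℝ =>
        |∑ i, θt i * (z i + Δ i)| + lam * N Δ ^ r)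
      (min |∑ i, θt i * z i| (lam * |∑ i, θt i * z i| ^ r / Nd ^ r)) := by
  have hN_nonneg := nonneg_of_triangle_of_smul N hN_triangle hN_smul
  let f : (Fin m → ℝ) →ₗ[ℝ] ℝ := dotProductBilin ℝ ℝ θt
  have hf : ∀ u, ∑ i, θt i * u i = f u := fun u => rfl
  have hf_add : ∀ u, ∑ i, θt i * (z i + u i) = f z + f u := fun u => by
    rw [← map_add]; rfl
  simp only [hf_add]
  simp only [hf] at hNd ⊢
  obtain ⟨u, hu, hmax⟩ :=
    exists_forall_le_of_norm_le_one N hN_triangle hN_smul hN_eq_zero f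
  obtain rfl : Nd = f u := by
    rw [hNd]
    refine IsGreatest.csSup_eq ⟨⟨u, hu, rfl⟩, ?_⟩
    rintro _ ⟨v, hv, rfl⟩
    exact hmax v hv
  have hle : ∀ v, f v ≤ f u * N v := fun v => by
    rcases (hN_nonneg v).eq_or_lt with h | h
    · rw [(hN_eq_zero v).1 h.symm, map_zero, (hN_eq_zero 0).2 rfl, mul_zero]
    · have h1 := hmax ((N v)⁻¹ • v) (by
        rw [hN_smul, abs_of_pos (inv_pos.2 h), inv_mul_cancel₀ h.ne'])
      rwa [map_smul, smul_eq_mul, inv_mul_le_iff₀ h, mul_comm] at h1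
  have habs : ∀ v, |f v| ≤ f u * N v := fun v => by
    refine abs_le'.2 ⟨hle v, ?_⟩
    have h1 := hle ((-1 : ℝ) • v)
    rwa [hN_smul, abs_neg, abs_one, one_mul, map_smul, neg_smul, one_smul] at h1
  have hpos : 0 < f u := by
    have h1 : 0 < ∑ i, θt i * θt i := by
      refine (Finset.sum_nonneg fun i _ => mul_self_nonneg (θt i)).lt_of_ne' ?_
      exact fun h => hθt (dotProduct_self_eq_zero.1 h)
    exact pos_of_mul_pos_left (h1.trans_le (hle θt)) (hN_nonneg θt)
  have hNu : N u = 1 := le_antisymm hu (le_of_mul_le_mul_left (by simpa using hle u) hpos)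
  constructor
  · rcases min_choice |f z| (lam * |f z| ^ r / f u ^ r) with h | h <;> rw [h]
    · exact ⟨0, by simp [(hN_eq_zero 0).2 rfl, Real.zero_rpow hr.1.ne']⟩
    · refine ⟨(-(f z / f u)) • u, ?_⟩
      simp only [map_smul, smul_eq_mul, hN_smul, hNu, neg_mul, div_mul_cancel₀ _ hpos.ne',
        add_neg_cancel, abs_zero, zero_add, mul_one, abs_neg, abs_div, abs_of_pos hpos]
      rw [Real.div_rpow (abs_nonneg _) hpos.le, mul_div_assoc]
  · rintro _ ⟨v, rfl⟩
    have hc : 0 ≤ lam / f u ^ r := div_nonneg hlam (Real.rpow_nonneg hpos.le r)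
    calc min |f z| (lam * |f z| ^ r / f u ^ r)
        = min |f z| (lam / f u ^ r * |f z| ^ r) := by rw [div_mul_eq_mul_div]
      _ ≤ |f z + f v| + lam / f u ^ r * |f v| ^ r :=
          min_abs_le_abs_add_add_mul_rpow hr.1 hr.2.le hc
      _ = |f z + f v| + lam * (|f v| / f u) ^ r := by
          rw [Real.div_rpow (abs_nonneg _) hpos.le]; ring
      _ ≤ |f z + f v| + lam * N v ^ r := by
          have hr0 := hr.1.le
          gcongr
          exact (div_le_iff₀' hpos).2 (habs v)
end

section
/- Let r ∈ (0,1), δ > 0, θ ∈ ℝ^d, and let z'_1, …, z'_n ∈ ℝ^d with empirical measure P'_n. Take the cost c(z,z') = ‖z − z'‖^r with the Euclidean norm ‖·‖. If (1/n)·∑_{i=1}^n ‖θ − z'_i‖^r ≤ δ, then D_c(δ_θ, P'_n) ≤ δ, and consequently the infimum of ∫ ‖θ − z‖ dQ(z) over all Borel probability measures Q on ℝ^d with D_c(Q, P'_n) ≤ δ equals 0. -/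
open MeasureTheory ENNReal

/-- The optimal transport cost between Borel probability measures `P` and `Q`:
the infimum of `∫ c dπ` over probability measures `π` on the product whose first
marginal is `P` and second marginal is `Q`. -/
noncomputable def transportCost {E : Type*} [MeasurableSpace E]
    (c : E → E → ℝ) (P Q : Measure E) : ℝ≥0∞ :=
  ⨅ (π : Measure (E × E)) (_ : IsProbabilityMeasure π)
    (_ : π.map Prod.fst = P) (_ : π.map Prod.snd = Q),
    ∫⁻ z, ENNReal.ofReal (c z.1 z.2) ∂π

/-- The empirical measure of the points `z'_1, …, z'_n`. -/
noncomputable def empiricalMeasure {E : Type*} [MeasurableSpace E] {n : ℕ}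
    (z' : Fin n → E) : Measure E :=
  (n : ℝ≥0∞)⁻¹ • ∑ i : Fin n, Measure.dirac (z' i)

theorem isProbabilityMeasure_empiricalMeasure {E : Type*} [MeasurableSpace E] {n : ℕ}
    (hn : 0 < n) (z' : Fin n → E) : IsProbabilityMeasure (empiricalMeasure z') := by
  refine ⟨?_⟩
  have h0 : (n : ℝ≥0∞) ≠ 0 := by exact_mod_cast hn.ne'
  simp [empiricalMeasure, ENNReal.inv_mul_cancel h0 (ENNReal.natCast_ne_top n)]

theorem lintegral_empiricalMeasure {E : Type*} [MeasurableSpace E] {n : ℕ}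
    (z' : Fin n → E) {f : E → ℝ≥0∞} (hf : Measurable f) :
    ∫⁻ z, f z ∂empiricalMeasure z' = (n : ℝ≥0∞)⁻¹ * ∑ i, f (z' i) := by
  simp [empiricalMeasure, lintegral_smul_measure, lintegral_finsetSum_measure,
    lintegral_dirac' _ hf]

/-- The coupling `δ_θ ⊗ Q` bounds the cost of transporting `δ_θ` to `Q`. -/
theorem transportCost_dirac_le {E : Type*} [MeasurableSpace E] {c : E → E → ℝ}
    (hc : Measurable fun p : E × E => c p.1 p.2) (θ : E) (Q : Measure E)
    [IsProbabilityMeasure Q] :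
    transportCost c (Measure.dirac θ) Q ≤ ∫⁻ z, ENNReal.ofReal (c θ z) ∂Q := by
  have hm : Measurable fun z : E => (θ, z) := measurable_prodMk_left
  refine (iInf_le _ (Q.map fun z => (θ, z))).trans ?_
  refine (iInf_le _ (Measure.isProbabilityMeasure_map hm.aemeasurable)).trans ?_
  refine (iInf_le _ ?_).trans ((iInf_le _ ?_).trans ?_)
  · rw [Measure.map_map measurable_fst hm]
    simp [Function.comp_def, Measure.map_const]
  · rw [Measure.map_map measurable_snd hm]
    exact Measure.map_id
  · rw [lintegral_map hc.ennreal_ofReal hm]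

/-- with cost `c(z,z') = ‖z−z'‖^r`, if
`(1/n) ∑ᵢ ‖θ − z'_i‖^r ≤ δ`, then `D_c(δ_θ, P'_n) ≤ δ`, and consequently the
infimum of `∫ ‖θ−z‖ dQ(z)` over Borel probability measures `Q` with
`D_c(Q, P'_n) ≤ δ` equals `0`. -/
theorem stmt_12 (d n : ℕ) (hn : 0 < n) (r δ : ℝ) (hr : r ∈ Set.Ioo (0 : ℝ) 1) (hδ : 0 < δ)
    (θ : EuclideanSpace ℝ (Fin d)) (z' : Fin n → EuclideanSpace ℝ (Fin d))
    (hsmall : (1 / n) * ∑ i : Fin n, ‖θ - z' i‖ ^ r ≤ δ) :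
    transportCost (fun z w => ‖z - w‖ ^ r) (Measure.dirac θ)
      (empiricalMeasure z') ≤ ENNReal.ofReal δ ∧
    sInf {v : ℝ | ∃ Q : Measure (EuclideanSpace ℝ (Fin d)),
        IsProbabilityMeasure Q ∧
        transportCost (fun z w => ‖z - w‖ ^ r) Q (empiricalMeasure z') ≤
          ENNReal.ofReal δ ∧
        v = ∫ z, ‖θ - z‖ ∂Q} = 0 := by
  have hprob := isProbabilityMeasure_empiricalMeasure hn z'
  have hle : transportCost (fun z w => ‖z - w‖ ^ r) (Measure.dirac θ)
      (empiricalMeasure z') ≤ ENNReal.ofReal δ := by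
    refine (transportCost_dirac_le (by fun_prop) θ _).trans ?_
    rw [lintegral_empiricalMeasure z' (by fun_prop),
      ← ENNReal.ofReal_sum_of_nonneg fun i _ => by positivity,
      ← ENNReal.ofReal_natCast n, ← ENNReal.ofReal_inv_of_pos (by exact_mod_cast hn),
      ← ENNReal.ofReal_mul (by positivity), ← one_div]
    exact ENNReal.ofReal_le_ofReal hsmall
  refine ⟨hle, IsLeast.csInf_eq ⟨⟨Measure.dirac θ, inferInstance, hle, ?_⟩, ?_⟩⟩
  · simp
  · rintro v ⟨Q, -, -, rfl⟩
    exact integral_nonneg fun z => norm_nonneg _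
end

section
/- Let a, b, λ > 0, define K(t) = (a − b·t)^2 + λ·t^{1/2} for t ∈ [0, a/b], define the cubic g(β) = b^2·β^3 − a·b·β + λ/4, and set β* = (a/(3b))^{1/2}. If g(β*) < 0, then g has exactly two roots β_− < β_+ in (0,∞), with β_+^2 < a/b; moreover K is increasing on [0, β_−^2], decreasing on [β_−^2, β_+^2], and increasing on [β_+^2, a/b], so the minimum of K over [0, a/b] is attained at t = 0 or at t = β_+^2. -/
theorem hasDerivAt_sq_sub_add_linear (a b lam s : ℝ) :
    HasDerivAt (fun s : ℝ => (a - b * s ^ 2) ^ 2 + lam * s)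
      (4 * (b ^ 2 * s ^ 3 - a * b * s + lam / 4)) s := by
  have h := ((((hasDerivAt_pow 2 s).const_mul b).const_sub a).pow 2).add
    ((hasDerivAt_id s).const_mul lam)
  refine h.congr_deriv ?_
  norm_num
  ring

theorem cubic_eq_mul_of_two_roots {a b c m p : ℝ} (hmp : m < p)
    (hm : b ^ 2 * m ^ 3 - a * b * m + c = 0) (hp : b ^ 2 * p ^ 3 - a * b * p + c = 0) (s : ℝ) :
    b ^ 2 * s ^ 3 - a * b * s + c = b ^ 2 * ((s - m) * (s - p) * (s + m + p)) := by
  have h : a * b = b ^ 2 * (m ^ 2 + m * p + p ^ 2) := by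
    refine mul_left_cancel₀ (sub_ne_zero.2 hmp.ne') ?_
    linear_combination hm - hp
  linear_combination hm - (s - m) * h

theorem strictMonoOn_comp_sqrt {f : ℝ → ℝ} {u v : ℝ} (hv : 0 ≤ v)
    (hf : StrictMonoOn f (Set.Icc u v)) :
    StrictMonoOn (fun t => f (√t)) (Set.Icc (u ^ 2) (v ^ 2)) :=
  hf.comp (fun _ hx _ _ hxy => Real.sqrt_lt_sqrt ((sq_nonneg u).trans hx.1) hxy)
    fun _ hx => ⟨Real.le_sqrt_of_sq_le hx.1, (Real.sqrt_le_left hv).2 hx.2⟩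

theorem strictAntiOn_comp_sqrt {f : ℝ → ℝ} {u v : ℝ} (hv : 0 ≤ v)
    (hf : StrictAntiOn f (Set.Icc u v)) :
    StrictAntiOn (fun t => f (√t)) (Set.Icc (u ^ 2) (v ^ 2)) :=
  fun _ hx _ hy hxy => neg_lt_neg_iff.1 (strictMonoOn_comp_sqrt hv hf.neg hx hy hxy)

theorem isLeast_image_Icc_left_or_of_mono_anti_mono {K : ℝ → ℝ} {x m p y : ℝ} (hxm : x ≤ m)
    (hmp : m ≤ p) (hpy : p ≤ y) (h₁ : MonotoneOn K (Set.Icc x m))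
    (h₂ : AntitoneOn K (Set.Icc m p)) (h₃ : MonotoneOn K (Set.Icc p y)) :
    IsLeast (K '' Set.Icc x y) (K x) ∨ IsLeast (K '' Set.Icc x y) (K p) := by
  have key : ∀ t ∈ Set.Icc x y, K x ≤ K t ∨ K p ≤ K t := by
    intro t ht
    rcases le_total t m with h | h
    · exact .inl (h₁ ⟨le_rfl, hxm⟩ ⟨ht.1, h⟩ ht.1)
    · rcases le_total t p with h' | h'
      · exact .inr (h₂ ⟨h, h'⟩ ⟨hmp, le_rfl⟩ h')
      · exact .inr (h₃ ⟨le_rfl, hpy⟩ ⟨h', ht.2⟩ h')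
  rcases le_total (K x) (K p) with h | h
  · refine .inl ⟨⟨x, ⟨le_rfl, by linarith⟩, rfl⟩, ?_⟩
    rintro _ ⟨t, ht, rfl⟩
    exact (key t ht).elim id h.trans
  · refine .inr ⟨⟨p, ⟨by linarith, hpy⟩, rfl⟩, ?_⟩
    rintro _ ⟨t, ht, rfl⟩
    exact (key t ht).elim h.trans id

/-- For `a, b, λ > 0`, `K(t) = (a − b t)² + λ t^{1/2}` on
`[0, a/b]`, the cubic `g(β) = b² β³ − a b β + λ/4`, and `β* = (a/(3b))^{1/2}`,
if `g(β*) < 0` then `g` has exactly two roots `β₋ < β₊` in `(0,∞)` with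
`β₊² < a/b`; moreover `K` is increasing on `[0, β₋²]`, decreasing on
`[β₋², β₊²]`, and increasing on `[β₊², a/b]`, so the minimum of `K` over
`[0, a/b]` is attained at `t = 0` or at `t = β₊²`. -/
theorem stmt_16 (a b lam : ℝ) (ha : 0 < a) (hb : 0 < b) (hlam : 0 < lam)
    (hg : b ^ 2 * ((a / (3 * b)) ^ ((1 : ℝ) / 2)) ^ 3 -
        a * b * (a / (3 * b)) ^ ((1 : ℝ) / 2) + lam / 4 < 0) :
    ∃ βm βp : ℝ, 0 < βm ∧ βm < βp ∧
      (b ^ 2 * βm ^ 3 - a * b * βm + lam / 4 = 0) ∧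
      (b ^ 2 * βp ^ 3 - a * b * βp + lam / 4 = 0) ∧
      (∀ β : ℝ, 0 < β → b ^ 2 * β ^ 3 - a * b * β + lam / 4 = 0 →
        β = βm ∨ β = βp) ∧
      βp ^ 2 < a / b ∧
      StrictMonoOn (fun t : ℝ => (a - b * t) ^ 2 + lam * t ^ ((1 : ℝ) / 2))
        (Set.Icc 0 (βm ^ 2)) ∧
      StrictAntiOn (fun t : ℝ => (a - b * t) ^ 2 + lam * t ^ ((1 : ℝ) / 2))
        (Set.Icc (βm ^ 2) (βp ^ 2)) ∧
      StrictMonoOn (fun t : ℝ => (a - b * t) ^ 2 + lam * t ^ ((1 : ℝ) / 2))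
        (Set.Icc (βp ^ 2) (a / b)) ∧
      (IsLeast ((fun t : ℝ => (a - b * t) ^ 2 + lam * t ^ ((1 : ℝ) / 2)) ''
          Set.Icc 0 (a / b))
          ((a - b * 0) ^ 2 + lam * (0 : ℝ) ^ ((1 : ℝ) / 2)) ∨
       IsLeast ((fun t : ℝ => (a - b * t) ^ 2 + lam * t ^ ((1 : ℝ) / 2)) ''
          Set.Icc 0 (a / b))
          ((a - b * βp ^ 2) ^ 2 + lam * (βp ^ 2) ^ ((1 : ℝ) / 2))) := by
  simp only [← Real.sqrt_eq_rpow] at hg ⊢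
  have hab : 0 < a / b := div_pos ha hb
  have hs : 0 < √(a / (3 * b)) := Real.sqrt_pos.2 (by positivity)
  have hsr : √(a / (3 * b)) < √(a / b) := by
    refine Real.sqrt_lt_sqrt (by positivity) ?_
    exact div_lt_div_of_pos_left ha hb (by linarith)
  have hr2 : √(a / b) ^ 2 = a / b := Real.sq_sqrt hab.le
  have hgr : b ^ 2 * √(a / b) ^ 3 - a * b * √(a / b) + lam / 4 = lam / 4 := by
    have h : b * √(a / b) ^ 2 = a := by rw [hr2]; field_simp
    linear_combination b * √(a / b) * h
  have hcont : Continuous fun β : ℝ => b ^ 2 * β ^ 3 - a * b * β + lam / 4 := by fun_prop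
  obtain ⟨m, ⟨hm0, hms⟩, hm⟩ := intermediate_value_Ioo' hs.le hcont.continuousOn
    (show (0 : ℝ) ∈ Set.Ioo _ _ from ⟨hg, by norm_num; exact hlam⟩)
  obtain ⟨p, ⟨hsp, hpr⟩, hp⟩ := intermediate_value_Ioo hsr.le hcont.continuousOn
    (show (0 : ℝ) ∈ Set.Ioo _ _ from ⟨hg, by simp only [hgr]; positivity⟩)
  have hmp : m < p := hms.trans hsp
  have hp0 : 0 < p := hm0.trans hmp
  have hfac := cubic_eq_mul_of_two_roots hmp hm hp
  have hb2 : 0 < b ^ 2 := by positivity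
  have hderiv : ∀ s, deriv (fun s : ℝ => (a - b * s ^ 2) ^ 2 + lam * s) s =
      4 * (b ^ 2 * ((s - m) * (s - p) * (s + m + p))) := fun s => by
    rw [(hasDerivAt_sq_sub_add_linear a b lam s).deriv, hfac]
  have hfc : Continuous fun s : ℝ => (a - b * s ^ 2) ^ 2 + lam * s := by fun_prop
  have hpr2 : p ^ 2 < a / b := hr2 ▸ pow_lt_pow_left₀ hpr hp0.le two_ne_zero
  have hK : ∀ t : ℝ, 0 ≤ t →
      (a - b * √t ^ 2) ^ 2 + lam * √t = (a - b * t) ^ 2 + lam * √t := fun t ht => by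
    rw [Real.sq_sqrt ht]
  have h₁ : StrictMonoOn (fun t : ℝ => (a - b * t) ^ 2 + lam * √t) (Set.Icc 0 (m ^ 2)) := by
    have h : StrictMonoOn (fun s : ℝ => (a - b * s ^ 2) ^ 2 + lam * s) (Set.Icc 0 m) := by
      refine strictMonoOn_of_deriv_pos (convex_Icc _ _) hfc.continuousOn fun s hs => ?_
      rw [interior_Icc] at hs
      rw [hderiv]
      have := mul_pos_of_neg_of_neg (sub_neg.2 hs.2) (sub_neg.2 (hs.2.trans hmp))
      have : 0 < s + m + p := by linarith [hs.1]
      positivity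
    have h' := strictMonoOn_comp_sqrt hm0.le h
    rw [zero_pow two_ne_zero] at h'
    exact h'.congr fun t ht => hK t ht.1
  have h₂ : StrictAntiOn (fun t : ℝ => (a - b * t) ^ 2 + lam * √t)
      (Set.Icc (m ^ 2) (p ^ 2)) := by
    have h : StrictAntiOn (fun s : ℝ => (a - b * s ^ 2) ^ 2 + lam * s) (Set.Icc m p) := by
      refine strictAntiOn_of_deriv_neg (convex_Icc _ _) hfc.continuousOn fun s hs => ?_
      rw [interior_Icc] at hs
      rw [hderiv]
      have h := mul_neg_of_pos_of_neg (sub_pos.2 hs.1) (sub_neg.2 hs.2)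
      have h' := mul_neg_of_neg_of_pos h (show 0 < s + m + p by linarith [hs.1])
      exact mul_neg_of_pos_of_neg four_pos (mul_neg_of_pos_of_neg hb2 h')
    exact (strictAntiOn_comp_sqrt hp0.le h).congr
      fun t ht => hK t ((sq_nonneg m).trans ht.1)
  have h₃ : StrictMonoOn (fun t : ℝ => (a - b * t) ^ 2 + lam * √t)
      (Set.Icc (p ^ 2) (a / b)) := by
    have h : StrictMonoOn (fun s : ℝ => (a - b * s ^ 2) ^ 2 + lam * s)
        (Set.Icc p √(a / b)) := by
      refine strictMonoOn_of_deriv_pos (convex_Icc _ _) hfc.continuousOn fun s hs => ?_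
      rw [interior_Icc] at hs
      rw [hderiv]
      have := mul_pos (sub_pos.2 (hmp.trans hs.1)) (sub_pos.2 hs.1)
      have : 0 < s + m + p := by linarith [hs.1]
      positivity
    have h' := strictMonoOn_comp_sqrt (Real.sqrt_nonneg _) h
    rw [hr2] at h'
    exact h'.congr fun t ht => hK t ((sq_nonneg p).trans ht.1)
  refine ⟨m, p, hm0, hmp, hm, hp, fun β hβ h => ?_, hpr2, h₁, h₂, h₃, ?_⟩
  · rw [hfac] at h
    have hne : β + m + p ≠ 0 := by positivity
    simpa [hb2.ne', hb.ne', hne, sub_eq_zero] using h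
  · exact isLeast_image_Icc_left_or_of_mono_anti_mono (sq_nonneg m)
      (pow_le_pow_left₀ hm0.le hmp.le 2) hpr2.le h₁.monotoneOn h₂.antitoneOn h₃.monotoneOn
end
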